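/- Let n ≥ 1 and fix a > 0. The operator norm ‖M_a^b‖_{L¹(ℝⁿ)→L¹(ℝⁿ)} tends to ∞ as b/a → ∞, and moreover ‖M_a^b‖_{L¹(ℝⁿ)→L¹(ℝⁿ)} / ln(b/a) tends to n as b/a → ∞. -/

import Mathlib

open MeasureTheory Metric Set ENNReal NNReal Filter

/-- The truncated Hardy–Littlewood maximal operator
`M_a^b f(x) = sup_{a<r<b} (1/|B(x,r)|) ∫_{B(x,r)} |f(y)| dy` on `ℝⁿ`. -/
noncomputable def truncMax (n : ℕ) (a b : ℝ) (f : EuclideanSpace ℝ (Fin n) → ℝ)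
    (x : EuclideanSpace ℝ (Fin n)) : ℝ≥0∞ :=
  ⨆ r ∈ Set.Ioo a b,
    (volume (Metric.ball x r))⁻¹ * ∫⁻ y in Metric.ball x r, (‖f y‖₊ : ℝ≥0∞)

/-- The operator norm of `M_a^b` on `L¹(ℝⁿ)`: the supremum of `‖M_a^b f‖₁` over
`f ∈ L¹(ℝⁿ)` with `‖f‖₁ = 1`. -/
noncomputable def truncMaxOpNorm (n : ℕ) (a b : ℝ) : ℝ≥0∞ :=
  ⨆ (f : EuclideanSpace ℝ (Fin n) → ℝ)
    (_ : Integrable f ∧ (∫⁻ x, (‖f x‖₊ : ℝ≥0∞)) = 1),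
    ∫⁻ x, truncMax n a b f x

/-- The integral of `1 / |B(0, ‖x‖)|` over the annulus `a ≤ ‖x‖ < c` is `n log (c / a)`. -/
theorem lintegral_annulus_inv_volume_ball (n : ℕ) (hn : 1 ≤ n) {a c : ℝ} (ha : 0 < a)
    (hac : a ≤ c) :
    ∫⁻ x in {x : EuclideanSpace ℝ (Fin n) | ‖x‖ ∈ Set.Ico a c},
      (volume (Metric.ball (0 : EuclideanSpace ℝ (Fin n)) ‖x‖))⁻¹ =
      ENNReal.ofReal (n * Real.log (c / a)) := by
  have : Nonempty (Fin n) := ⟨⟨0, hn⟩⟩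
  set V := volume (Metric.ball (0 : EuclideanSpace ℝ (Fin n)) 1) with hV
  have hV0 : V ≠ 0 := (Metric.measure_ball_pos volume _ one_pos).ne'
  have hVt : V ≠ ⊤ := measure_ball_lt_top.ne
  have hVr : 0 < V.toReal := ENNReal.toReal_pos hV0 hVt
  set h : ℝ → ℝ := (Set.Ico a c).indicator fun t => (V.toReal * t ^ n)⁻¹ with hh
  have hmeas : MeasurableSet {x : EuclideanSpace ℝ (Fin n) | ‖x‖ ∈ Set.Ico a c} :=
    measurable_norm measurableSet_Ico
  have hnonneg : ∀ t, 0 ≤ h t := fun t =>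
    Set.indicator_nonneg (fun t ht => by have := ha.trans_le ht.1; positivity) t
  have hradial : ∀ t ∈ Set.Ioi (0 : ℝ), t ^ (n - 1) • h t =
      (Set.Ico a c).indicator (fun t => V.toReal⁻¹ * t⁻¹) t := by
    intro t ht
    have ht0 : (t : ℝ) ≠ 0 := (Set.mem_Ioi.1 ht).ne'
    by_cases htac : t ∈ Set.Ico a c
    · simp only [hh, Set.indicator_of_mem htac, smul_eq_mul]
      obtain ⟨m, rfl⟩ := Nat.exists_eq_add_of_le' hn
      simp only [Nat.add_sub_cancel]
      field_simp
      ring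
    · simp [hh, Set.indicator_of_notMem htac]
  have hsub : Set.Ico a c ⊆ Set.Ioi 0 := fun t ht => ha.trans_le ht.1
  have hint : Integrable (fun x : EuclideanSpace ℝ (Fin n) => h ‖x‖) := by
    rw [integrable_fun_norm_addHaar volume, finrank_euclideanSpace_fin,
      integrableOn_congr_fun hradial measurableSet_Ioi]
    apply Integrable.integrableOn
    rw [integrable_indicator_iff measurableSet_Ico]
    refine (ContinuousOn.integrableOn_Icc (a := a) (b := c) ?_).mono_set Set.Ico_subset_Icc_self
    refine continuousOn_const.mul (continuousOn_id.inv₀ fun t ht => ?_)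
    exact (ha.trans_le ht.1).ne'
  have hval : ∫ x : EuclideanSpace ℝ (Fin n), h ‖x‖ = n * Real.log (c / a) := by
    rw [integral_fun_norm_addHaar volume h, finrank_euclideanSpace_fin,
      setIntegral_congr_fun measurableSet_Ioi hradial,
      setIntegral_indicator measurableSet_Ico, Set.inter_eq_right.2 hsub,
      integral_Ico_eq_integral_Ioo, ← integral_Ioc_eq_integral_Ioo,
      integral_const_mul, ← intervalIntegral.integral_of_le hac,
      integral_inv_of_pos ha (ha.trans_le hac), measureReal_def, ← hV]
    simp only [nsmul_eq_mul, smul_eq_mul]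
    field_simp
  rw [← hval, ofReal_integral_eq_lintegral_ofReal hint (Eventually.of_forall fun x => hnonneg _),
    ← lintegral_indicator hmeas]
  refine lintegral_congr fun x => ?_
  by_cases hx : ‖x‖ ∈ Set.Ico a c
  · have hx0 : 0 < ‖x‖ := ha.trans_le hx.1
    rw [Set.indicator_of_mem (show x ∈ {x | ‖x‖ ∈ Set.Ico a c} from hx), hh,
      Set.indicator_of_mem hx, Measure.addHaar_ball_of_pos _ _ hx0, finrank_euclideanSpace_fin,
      ENNReal.ofReal_inv_of_pos (by positivity), ENNReal.ofReal_mul hVr.le,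
      ENNReal.ofReal_toReal hVt, mul_comm]
  · rw [Set.indicator_of_notMem (show x ∉ {x | ‖x‖ ∈ Set.Ico a c} from hx), hh,
      Set.indicator_of_notMem hx, ENNReal.ofReal_zero]

/-- The radial kernel dominating all averaging kernels of radius between `a` and `b`. -/
noncomputable def truncKernel (n : ℕ) (a b : ℝ) (z : EuclideanSpace ℝ (Fin n)) : ℝ≥0∞ :=
  (Metric.ball (0 : EuclideanSpace ℝ (Fin n)) a).indicator
      (fun _ => (volume (Metric.ball (0 : EuclideanSpace ℝ (Fin n)) a))⁻¹) z +
    {x : EuclideanSpace ℝ (Fin n) | ‖x‖ ∈ Set.Ico a b}.indicator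
      (fun x => (volume (Metric.ball (0 : EuclideanSpace ℝ (Fin n)) ‖x‖))⁻¹) z

theorem measurable_inv_volume_ball_norm (n : ℕ) :
    Measurable fun x : EuclideanSpace ℝ (Fin n) =>
      (volume (Metric.ball (0 : EuclideanSpace ℝ (Fin n)) ‖x‖))⁻¹ := by
  have hmono : Monotone fun r : ℝ => volume (Metric.ball (0 : EuclideanSpace ℝ (Fin n)) r) :=
    fun r s hrs => measure_mono (Metric.ball_subset_ball hrs)
  exact (hmono.measurable.comp measurable_norm).inv

theorem measurable_truncKernel (n : ℕ) (a b : ℝ) : Measurable (truncKernel n a b) :=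
  (measurable_const.indicator measurableSet_ball).add
    ((measurable_inv_volume_ball_norm n).indicator (measurable_norm measurableSet_Ico))

theorem lintegral_truncKernel (n : ℕ) (hn : 1 ≤ n) {a b : ℝ} (ha : 0 < a) (hab : a ≤ b) :
    ∫⁻ z, truncKernel n a b z = 1 + ENNReal.ofReal (n * Real.log (b / a)) := by
  simp only [truncKernel]
  rw [lintegral_add_left (measurable_const.indicator measurableSet_ball),
    lintegral_indicator measurableSet_ball, setLIntegral_const,
    ENNReal.inv_mul_cancel (Metric.measure_ball_pos volume _ ha).ne' measure_ball_lt_top.ne,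
    lintegral_indicator (show MeasurableSet {x : EuclideanSpace ℝ (Fin n) | ‖x‖ ∈ Set.Ico a b} from
      measurable_norm measurableSet_Ico),
    lintegral_annulus_inv_volume_ball n hn ha hab]

/-- The maximal function is dominated by convolution with `truncKernel`. -/
theorem truncMax_le_lintegral_truncKernel (n : ℕ) (a b : ℝ) (f : EuclideanSpace ℝ (Fin n) → ℝ)
    (x : EuclideanSpace ℝ (Fin n)) :
    truncMax n a b f x ≤ ∫⁻ y, truncKernel n a b (x - y) * (‖f y‖₊ : ℝ≥0∞) := by
  refine iSup₂_le fun r hr => ?_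
  refine (lintegral_const_mul_le _ _).trans ?_
  rw [← lintegral_indicator measurableSet_ball]
  refine lintegral_mono fun y => ?_
  by_cases hy : y ∈ Metric.ball x r
  · rw [Set.indicator_of_mem hy]
    refine mul_le_mul_left ?_ _
    have hyr : ‖x - y‖ < r := by rwa [← dist_eq_norm, dist_comm]
    rw [Measure.addHaar_ball_center]
    by_cases h : ‖x - y‖ < a
    · refine le_trans ?_ le_self_add
      rw [Set.indicator_of_mem (by simpa using h)]
      exact ENNReal.inv_le_inv.2 (measure_mono (Metric.ball_subset_ball hr.1.le))
    · refine le_trans ?_ le_add_self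
      have hmem : x - y ∈ {z : EuclideanSpace ℝ (Fin n) | ‖z‖ ∈ Set.Ico a b} :=
        ⟨not_lt.1 h, hyr.trans hr.2⟩
      rw [Set.indicator_of_mem hmem]
      exact ENNReal.inv_le_inv.2 (measure_mono (Metric.ball_subset_ball hyr.le))
  · simp [Set.indicator_of_notMem hy]

theorem truncMaxOpNorm_le (n : ℕ) (hn : 1 ≤ n) {a b : ℝ} (ha : 0 < a) (hab : a ≤ b) :
    truncMaxOpNorm n a b ≤ 1 + ENNReal.ofReal (n * Real.log (b / a)) := by
  refine iSup₂_le fun f hf => ?_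
  refine (lintegral_mono (truncMax_le_lintegral_truncKernel n a b f)).trans ?_
  have hfm : AEMeasurable (fun y => (‖f y‖₊ : ℝ≥0∞)) := hf.1.aestronglyMeasurable.enorm
  have hjoint : AEMeasurable (Function.uncurry fun x y : EuclideanSpace ℝ (Fin n) =>
      truncKernel n a b (x - y) * (‖f y‖₊ : ℝ≥0∞)) (volume.prod volume) :=
    ((measurable_truncKernel n a b).comp (measurable_fst.sub measurable_snd)).aemeasurable.mul
      (hfm.comp_quasiMeasurePreserving Measure.quasiMeasurePreserving_snd)
  rw [lintegral_lintegral_swap hjoint]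
  have hinner : ∀ y, ∫⁻ x, truncKernel n a b (x - y) * (‖f y‖₊ : ℝ≥0∞) =
      (1 + ENNReal.ofReal (n * Real.log (b / a))) * (‖f y‖₊ : ℝ≥0∞) := fun y => by
    have hm : Measurable fun x => truncKernel n a b (x - y) :=
      (measurable_truncKernel n a b).comp (measurable_id.sub_const y)
    rw [lintegral_mul_const _ hm,
      lintegral_sub_right_eq_self (truncKernel n a b) y, lintegral_truncKernel n hn ha hab]
  simp_rw [hinner]
  rw [lintegral_const_mul'' _ hfm, hf.2, mul_one]

/-- Lower bound obtained by testing on the normalised indicator of the ball of radius `ε * a`. -/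
theorem ofReal_le_truncMaxOpNorm_of_pos (n : ℕ) (hn : 1 ≤ n) {a b ε : ℝ} (ha : 0 < a)
    (hε : 0 < ε) (hab : a ≤ b / (1 + ε)) :
    ENNReal.ofReal (((1 + ε) ^ n)⁻¹ * (n * Real.log (b / (1 + ε) / a))) ≤
      truncMaxOpNorm n a b := by
  set B := Metric.ball (0 : EuclideanSpace ℝ (Fin n)) (ε * a) with hB
  have hB0 : volume B ≠ 0 := (Metric.measure_ball_pos volume _ (by positivity)).ne'
  have hBt : volume B ≠ ⊤ := measure_ball_lt_top.ne
  set f : EuclideanSpace ℝ (Fin n) → ℝ := B.indicator fun _ => (volume B).toReal⁻¹ with hf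
  have hfn : ∀ y, (‖f y‖₊ : ℝ≥0∞) = B.indicator (fun _ => (volume B)⁻¹) y := fun y => by
    by_cases hy : y ∈ B
    · rw [hf, Set.indicator_of_mem hy, Set.indicator_of_mem hy, ← enorm_eq_nnnorm,
        Real.enorm_of_nonneg (by positivity),
        ENNReal.ofReal_inv_of_pos (ENNReal.toReal_pos hB0 hBt), ENNReal.ofReal_toReal hBt]
    · simp [hf, Set.indicator_of_notMem hy]
  have hfi : Integrable f :=
    (integrable_indicator_iff measurableSet_ball).2 (integrableOn_const hBt)
  have hmass : ∀ s, B ⊆ s → ∫⁻ y in s, (‖f y‖₊ : ℝ≥0∞) = 1 := fun s hs => by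
    simp_rw [hfn]
    rw [setLIntegral_indicator measurableSet_ball, Set.inter_eq_left.2 hs, setLIntegral_const,
      ENNReal.inv_mul_cancel hB0 hBt]
  have hf1 : ∫⁻ y, (‖f y‖₊ : ℝ≥0∞) = 1 := by
    simpa using hmass Set.univ (Set.subset_univ _)
  refine le_trans ?_ (le_iSup₂_of_le f ⟨hfi, hf1⟩ le_rfl)
  rw [ENNReal.ofReal_mul (by positivity), ← lintegral_annulus_inv_volume_ball n hn ha hab,
    ← lintegral_const_mul _ (measurable_inv_volume_ball_norm n)]
  refine le_trans (setLIntegral_mono' (measurable_norm measurableSet_Ico) fun x hx => ?_)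
    (setLIntegral_le_lintegral _ _)
  obtain ⟨hax, hxb⟩ := hx
  have hx0 : 0 < ‖x‖ := ha.trans_le hax
  have hr : (1 + ε) * ‖x‖ ∈ Set.Ioo a b := by
    constructor
    · nlinarith
    · rwa [lt_div_iff₀ (by positivity), mul_comm] at hxb
  refine le_iSup₂_of_le _ hr ?_
  rw [hmass _ (Metric.ball_subset_ball' ?_), mul_one,
    Measure.addHaar_ball_of_pos _ _ (by positivity : 0 < (1 + ε) * ‖x‖),
    Measure.addHaar_ball_of_pos _ _ hx0, finrank_euclideanSpace_fin, mul_pow,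
    ENNReal.ofReal_mul (by positivity), mul_assoc,
    ENNReal.ofReal_inv_of_pos (by positivity),
    ← ENNReal.mul_inv (Or.inr ?_) (Or.inl ENNReal.ofReal_ne_top)]
  · exact ENNReal.mul_ne_top ENNReal.ofReal_ne_top measure_ball_lt_top.ne
  · rw [dist_zero_left]
    nlinarith

theorem ofReal_le_truncMaxOpNorm (n : ℕ) (hn : 1 ≤ n) {a b : ℝ} (ha : 0 < a) (hab : a < b) :
    ENNReal.ofReal (n * Real.log (b / a)) ≤ truncMaxOpNorm n a b := by
  have hb : 0 < b := ha.trans hab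
  have hdiv : ContinuousAt (fun ε : ℝ => b / (1 + ε)) 0 := by
    fun_prop (disch := norm_num)
  have hcont : ContinuousAt
      (fun ε : ℝ => ((1 + ε) ^ n)⁻¹ * (n * Real.log (b / (1 + ε) / a))) 0 := by
    refine ContinuousAt.mul (by fun_prop (disch := norm_num))
      (continuousAt_const.mul ((hdiv.div_const a).log ?_))
    simp only [add_zero, div_one]
    positivity
  have hlim := (ENNReal.tendsto_ofReal hcont.tendsto).mono_left
    (nhdsWithin_le_nhds (s := Set.Ioi 0))
  simp only [add_zero, one_pow, inv_one, one_mul, div_one] at hlim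
  refine le_of_tendsto hlim ?_
  have hev : ∀ᶠ ε in nhds (0 : ℝ), a < b / (1 + ε) :=
    hdiv.tendsto.eventually_const_lt (by simpa using hab)
  filter_upwards [self_mem_nhdsWithin, nhdsWithin_le_nhds hev] with ε hε hεb
  exact ofReal_le_truncMaxOpNorm_of_pos n hn ha hε hεb.le

/-- For fixed `a > 0`, the `L¹` operator norm of `M_a^b` tends to `∞` as `b/a → ∞`,
and `‖M_a^b‖ / ln(b/a)` tends to `n` as `b/a → ∞`. -/
theorem truncMaxOpNorm_asymptotics (n : ℕ) (hn : 1 ≤ n) (a : ℝ) (ha : 0 < a) :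
    Tendsto (fun b : ℝ => truncMaxOpNorm n a b) atTop (nhds ⊤) ∧
    Tendsto (fun b : ℝ => truncMaxOpNorm n a b / ENNReal.ofReal (Real.log (b / a)))
      atTop (nhds (n : ℝ≥0∞)) := by
  have hn0 : (0 : ℝ) < n := by exact_mod_cast hn
  have hlog : Tendsto (fun b : ℝ => Real.log (b / a)) atTop atTop :=
    Real.tendsto_log_atTop.comp (tendsto_id.atTop_div_const ha)
  constructor
  · refine tendsto_nhds_top_mono
      (ENNReal.tendsto_ofReal_atTop.comp (hlog.const_mul_atTop hn0)) ?_
    filter_upwards [eventually_gt_atTop a] with b hb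
    exact ofReal_le_truncMaxOpNorm n hn ha hb
  · have hupper : Tendsto (fun b : ℝ => (ENNReal.ofReal (Real.log (b / a)))⁻¹ + (n : ℝ≥0∞))
        atTop (nhds (n : ℝ≥0∞)) := by
      have hinv := tendsto_inv_iff.2 (ENNReal.tendsto_ofReal_atTop.comp hlog)
      simpa using hinv.add_const (n : ℝ≥0∞)
    have hfrac : ∀ {L : ℝ}, 0 < L →
        ENNReal.ofReal (n * L) / ENNReal.ofReal L = (n : ℝ≥0∞) := fun {L} hL => by
      rw [ENNReal.ofReal_mul hn0.le, ENNReal.ofReal_natCast,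
        ENNReal.mul_div_cancel_right (ENNReal.ofReal_pos.2 hL).ne' ENNReal.ofReal_ne_top]
    refine tendsto_of_tendsto_of_tendsto_of_le_of_le' tendsto_const_nhds hupper ?_ ?_
    · filter_upwards [eventually_gt_atTop a, hlog.eventually_gt_atTop 0] with b hb hL
      rw [← hfrac hL]
      exact ENNReal.div_le_div_right (ofReal_le_truncMaxOpNorm n hn ha hb) _
    · filter_upwards [eventually_gt_atTop a, hlog.eventually_gt_atTop 0] with b hb hL
      refine (ENNReal.div_le_div_right (truncMaxOpNorm_le n hn ha hb.le) _).trans_eq ?_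
      rw [ENNReal.add_div, hfrac hL, one_div]
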